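/- Let G be a finite abelian group, let x ∈ G, and let χ : G → ℂ* be a one-dimensional character (group homomorphism into the nonzero complex numbers). Set K = Ker(χ) ∩ ⟨x⟩, let d denote the order of x and k = |K|. Then ∑_{s ∈ [x^G]} χ(s) = μ(d/k) · φ(d) / φ(d/k), where μ is the classical Möbius function and φ is Euler's totient function. -/

import Mathlib

open Finset in
/-- The sum of the primitive `n`-th roots of unity is the Möbius function at `n`. -/
theorem sum_primitiveRoots_complex {n : ℕ} (hn : 0 < n) :
    ∑ z ∈ primitiveRoots n ℂ, z = (ArithmeticFunction.moebius n : ℂ) := by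
  classical
  have key : ∀ m > 0, ∑ i ∈ m.divisors, ∑ z ∈ primitiveRoots i ℂ, z = if m = 1 then 1 else 0 := by
    intro m hm
    rw [← sum_biUnion fun i _ j _ hij => IsPrimitiveRoot.disjoint hij,
      ← IsPrimitiveRoot.nthRoots_one_eq_biUnion_primitiveRoots]
    have hζ := Complex.isPrimitiveRoot_exp m hm.ne'
    have : NeZero m := ⟨hm.ne'⟩
    have himage : Polynomial.nthRootsFinset m (1 : ℂ) =
        (range m).image (Complex.exp (2 * Real.pi * Complex.I / m) ^ ·) := by
      ext z
      simp only [Polynomial.mem_nthRootsFinset hm, mem_image, mem_range]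
      refine ⟨hζ.eq_pow_of_pow_eq_one, ?_⟩
      rintro ⟨i, -, rfl⟩
      rw [← pow_mul, mul_comm i m, pow_mul, hζ.pow_eq_one, one_pow]
    rw [himage, sum_image fun i hi j hj h => hζ.pow_inj (by simpa using hi) (by simpa using hj) h]
    split_ifs with h
    · simp [h]
    · exact hζ.geom_sum_eq_zero (by omega)
  rw [← ArithmeticFunction.sum_eq_iff_sum_mul_moebius_eq.1 key n hn,
    sum_eq_single (n, 1)]
  · simp
  · rintro ⟨a, b⟩ hab hne
    rw [Nat.mem_divisorsAntidiagonal] at hab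
    have : b ≠ 1 := by rintro rfl; simp_all
    simp [this]
  · simp [hn.ne']

open Finset in
/-- The powers of a primitive `n`-th root of unity with exponents coprime to `n` are the primitive
`n`-th roots of unity. -/
theorem IsPrimitiveRoot.sum_pow_coprime {R : Type*} [CommRing R] [IsDomain R] {n : ℕ} (hn : 0 < n)
    {ζ : R} (hζ : IsPrimitiveRoot ζ n) :
    ∑ i ∈ range n with n.Coprime i, ζ ^ i = ∑ z ∈ primitiveRoots n R, z := by
  have : NeZero n := ⟨hn.ne'⟩
  refine sum_nbij (ζ ^ ·) ?_ ?_ ?_ fun _ _ => rfl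
  · intro i hi
    simp only [mem_filter, mem_range] at hi
    exact (mem_primitiveRoots hn).2 (hζ.pow_of_coprime i hi.2.symm)
  · intro i hi j hj h
    simp only [coe_filter, mem_range, Set.mem_ofPred_eq] at hi hj
    exact hζ.pow_inj hi.1 hj.1 h
  · intro z hz
    obtain ⟨i, hi, hin, rfl⟩ := hζ.isPrimitiveRoot_iff.1 ((mem_primitiveRoots hn).1 hz)
    exact ⟨i, by simpa [hi] using hin.symm, rfl⟩

/-- A residue coprime to `n` lifts to one coprime to any given nonzero multiple of `n`. -/
theorem Nat.Coprime.exists_modEq_coprime {n N i : ℕ} (hN : N ≠ 0) (h : n ∣ N)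
    (hi : n.Coprime i) : ∃ j, N.Coprime j ∧ j ≡ i [MOD n] := by
  have : NeZero N := ⟨hN⟩
  obtain ⟨u, hu⟩ := ZMod.unitsMap_surjective h (ZMod.unitOfCoprime i hi.symm)
  refine ⟨(u : ZMod N).val, (ZMod.val_coe_unit_coprime u).symm, ?_⟩
  rw [← ZMod.natCast_eq_natCast_iff, ZMod.natCast_val]
  simpa [ZMod.unitsMap_def] using congrArg Units.val hu

/-- A finite cyclic subgroup of order `d` has `φ d` generators. -/
theorem Subgroup.card_filter_zpowers_eq {G : Type*} [Group G] [Fintype G] (x : G)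
    [DecidablePred fun y : G => zpowers y = zpowers x] :
    (Finset.univ.filter fun y : G => zpowers y = zpowers x).card = (orderOf x).totient := by
  classical
  have hcard : Fintype.card (zpowers x) = orderOf x := Fintype.card_zpowers
  rw [← IsCyclic.card_orderOf_eq_totient (α := zpowers x) (d := orderOf x) (by rw [hcard])]
  symm
  refine Finset.card_nbij Subtype.val ?_ Subtype.val_injective.injOn ?_
  · rintro ⟨y, hy⟩ h
    simp only [Finset.coe_filter, Finset.mem_univ, true_and, Set.mem_ofPred_eq,
      Subgroup.orderOf_mk] at h ⊢
    exact eq_of_le_of_card_ge (zpowers_le.2 hy) (by rw [Nat.card_zpowers, Nat.card_zpowers, h])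
  · intro y hy
    simp only [Finset.coe_filter, Finset.mem_univ, true_and, Set.mem_ofPred_eq] at hy
    refine ⟨⟨y, hy ▸ mem_zpowers y⟩, ?_, rfl⟩
    simp only [Finset.coe_filter, Finset.mem_univ, true_and, Set.mem_ofPred_eq, Subgroup.orderOf_mk]
    rw [← Nat.card_zpowers, hy, Nat.card_zpowers]

/-- The order of the image of `x` is the index of the kernel in `zpowers x`. -/
theorem MonoidHom.orderOf_div_card_ker_inf_zpowers {G H : Type*} [Group G] [Finite G] [Group H]
    (f : G →* H) (x : G) :
    orderOf x / Nat.card (f.ker ⊓ Subgroup.zpowers x : Subgroup G) = orderOf (f x) := by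
  have h := Subgroup.relIndex_mul_relIndex (⊥ : Subgroup G) (f.ker ⊓ Subgroup.zpowers x)
    (Subgroup.zpowers x) bot_le inf_le_right
  rw [Subgroup.relIndex_bot_left, Subgroup.relIndex_bot_left, Subgroup.inf_relIndex_right,
    Subgroup.relIndex_ker, MonoidHom.map_zpowers, Nat.card_zpowers, Nat.card_zpowers] at h
  rw [← h, Nat.mul_div_cancel_left _ Nat.card_pos]

/-- A power of `y` with exponent coprime to the order of the group generates the same subgroup
as `y`. -/
theorem Subgroup.zpowers_pow_of_coprime_card {G : Type*} [Group G] [Finite G] {j : ℕ}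
    (hj : (Nat.card G).Coprime j) (y : G) : zpowers (y ^ j) = zpowers y :=
  eq_of_le_of_card_ge (zpowers_le.2 (npow_mem_zpowers y j)) <| by
    rw [Nat.card_zpowers, Nat.card_zpowers,
      (Nat.Coprime.coprime_dvd_left (_root_.orderOf_dvd_natCard y) hj).orderOf_pow]

/-- Corollary 4.5: for a finite abelian group `G`, `x ∈ G`, and a one-dimensional character
`χ : G → ℂ*`, with `K = Ker(χ) ∩ ⟨x⟩`, `d` the order of `x` and `k = |K|`,
`∑_{s ∈ [x^G]} χ(s) = μ(d/k) · φ(d) / φ(d/k)`, where `[x^G]` is the set of generators of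
`⟨x⟩`, `μ` is the classical Möbius function and `φ` is Euler's totient function. -/
theorem stmt_15 {G : Type*} [CommGroup G] [Fintype G] (x : G) (χ : G →* ℂˣ) :
    ∑ᶠ s ∈ {y : G | Subgroup.zpowers y = Subgroup.zpowers x}, ((χ s : ℂˣ) : ℂ) =
      ((ArithmeticFunction.moebius
          (orderOf x / Nat.card (χ.ker ⊓ Subgroup.zpowers x : Subgroup G)) : ℤ) : ℂ) *
        (Nat.totient (orderOf x) : ℂ) /
        (Nat.totient (orderOf x / Nat.card (χ.ker ⊓ Subgroup.zpowers x : Subgroup G)) : ℂ) := by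
  classical
  rw [MonoidHom.orderOf_div_card_ker_inf_zpowers]
  set n := orderOf (χ x) with hn
  have hnG : n ∣ Nat.card G := (orderOf_map_dvd χ x).trans (orderOf_dvd_natCard x)
  have hn0 : 0 < n := Nat.pos_of_dvd_of_pos hnG Nat.card_pos
  set X : Finset G := Finset.univ.filter fun y => Subgroup.zpowers y = Subgroup.zpowers x with hX
  have hsum : ∑ᶠ s ∈ {y : G | Subgroup.zpowers y = Subgroup.zpowers x}, ((χ s : ℂˣ) : ℂ) =
      ∑ s ∈ X, ((χ s : ℂˣ) : ℂ) := by
    rw [← finsum_mem_coe_finset]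
    simp [hX]
  have hroot : ∀ s ∈ X, IsPrimitiveRoot ((χ s : ℂˣ) : ℂ) n := by
    intro s hs
    have hs : Subgroup.zpowers s = Subgroup.zpowers x := by simpa [hX] using hs
    have : orderOf (χ s) = n := by
      rw [hn, ← Nat.card_zpowers, ← Nat.card_zpowers, ← MonoidHom.map_zpowers, hs,
        MonoidHom.map_zpowers]
    rw [IsPrimitiveRoot.coe_units_iff, ← this]
    exact IsPrimitiveRoot.orderOf _
  have hpow : ∀ i, n.Coprime i →
      ∑ s ∈ X, ((χ s : ℂˣ) : ℂ) ^ i = ∑ s ∈ X, ((χ s : ℂˣ) : ℂ) := by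
    intro i hi
    obtain ⟨j, hj, hji⟩ := hi.exists_modEq_coprime Nat.card_pos.ne' hnG
    refine Finset.sum_equiv (powCoprime hj) (fun s => ?_) fun s hs => ?_
    · simp [hX, Subgroup.zpowers_pow_of_coprime_card hj]
    · rw [powCoprime_apply, map_pow, Units.val_pow_eq_pow_val]
      exact pow_eq_pow_of_modEq hji.symm (hroot s hs).pow_eq_one
  have hdouble : (n.totient : ℂ) * ∑ s ∈ X, ((χ s : ℂˣ) : ℂ) =
      ((orderOf x).totient : ℂ) * (ArithmeticFunction.moebius n : ℂ) := by
    calc (n.totient : ℂ) * ∑ s ∈ X, ((χ s : ℂˣ) : ℂ)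
        = ∑ i ∈ Finset.range n with n.Coprime i, ∑ s ∈ X, ((χ s : ℂˣ) : ℂ) ^ i := by
          rw [Finset.sum_congr rfl fun i hi => hpow i (Finset.mem_filter.1 hi).2,
            Finset.sum_const, nsmul_eq_mul, Nat.totient]
      _ = ∑ s ∈ X, (ArithmeticFunction.moebius n : ℂ) := by
          rw [Finset.sum_comm]
          exact Finset.sum_congr rfl fun s hs => by
            rw [(hroot s hs).sum_pow_coprime hn0, sum_primitiveRoots_complex hn0]
      _ = _ := by
          rw [Finset.sum_const, nsmul_eq_mul, hX, Subgroup.card_filter_zpowers_eq]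
  have hφ : (n.totient : ℂ) ≠ 0 := Nat.cast_ne_zero.2 (Nat.totient_pos.2 hn0).ne'
  rw [hsum, eq_div_iff hφ, mul_comm, hdouble, mul_comm]
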